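/- Let w be a π-minuscule element for a dominant integral weight π, and let v ∈ [id, w]^π, so that H(v) is canonically an order filter of H(w). Then the following are equivalent: (a) there are no nontrivial excited diagrams of H(v) in H(w), i.e. |E_{H(w)}(H(v))| = 1; (b) w v^{−1} is π′-minuscule for some dominant integral weight π′. -/

import Mathlib

open scoped Classical BigOperators

/-- A bundled setting for a finite crystallographic root system together with its
Weyl group, its action on the rational span of the weight lattice, reflections,
and the data of coefficients of roots in the basis of simple roots. -/
structure WeylSetting where
  /-- index set of the Dynkin diagram (simple roots) -/
  I : Type
  [fintypeI : Fintype I]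
  [decEqI : DecidableEq I]
  /-- rational span of the weight lattice -/
  V : Type
  [acg : AddCommGroup V]
  [mod : Module ℚ V]
  /-- the Weyl group -/
  W : Type
  [grp : Group W]
  /-- the action of the Weyl group on weights -/
  act : W →* (V ≃ₗ[ℚ] V)
  /-- the simple roots -/
  simple : I → V
  /-- the (finite) set of roots -/
  roots : Finset V
  /-- `coroot β μ` is the pairing `⟨μ, β∨⟩` -/
  coroot : V → (V →ₗ[ℚ] ℚ)
  /-- the reflection `s_β ∈ W` associated to a root `β` -/
  srefl : V → W
  /-- coefficients of a positive root in the basis of simple roots -/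
  posCoeff : V → I → ℕ
  simple_mem : ∀ i, simple i ∈ roots
  simple_indep : LinearIndependent ℚ simple
  roots_neg : ∀ β ∈ roots, -β ∈ roots
  root_pos_or_neg : ∀ β ∈ roots,
    (∃ c : I → ℚ, (∀ i, 0 ≤ c i) ∧ β = ∑ i, c i • simple i) ∨
    (∃ c : I → ℚ, (∀ i, 0 ≤ c i) ∧ -β = ∑ i, c i • simple i)
  coroot_self : ∀ β ∈ roots, coroot β β = 2
  crystallographic : ∀ β ∈ roots, ∀ γ ∈ roots, ∃ n : ℤ, coroot β γ = n
  posCoeff_spec : ∀ β ∈ roots,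
    (∃ c : I → ℚ, (∀ i, 0 ≤ c i) ∧ β = ∑ i, c i • simple i) →
    β = ∑ i, (posCoeff β i : ℚ) • simple i
  srefl_apply : ∀ β ∈ roots, ∀ v : V, act (srefl β) v = v - coroot β v • β
  act_faithful : ∀ g : W, (∀ v : V, act g v = v) → g = 1
  roots_invariant : ∀ g : W, ∀ β ∈ roots, act g β ∈ roots
  coroot_equivariant : ∀ g : W, ∀ β ∈ roots, ∀ v : V,
    coroot (act g β) (act g v) = coroot β v
  generated : ∀ g : W, ∃ l : List I, g = (l.map fun i => srefl (simple i)).prod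

namespace WeylSetting

attribute [instance] fintypeI decEqI acg mod grp

variable (D : WeylSetting)

/-- the simple reflection attached to a node of the Dynkin diagram -/
def s (i : D.I) : D.W := D.srefl (D.simple i)

/-- the product `s_{i_1} ⋯ s_{i_r}` of the simple reflections listed in `l` -/
def wordProd (l : List D.I) : D.W := (l.map D.s).prod

/-- `β` is a positive root: a root which is a nonnegative combination of simple roots -/
def IsPosRoot (β : D.V) : Prop :=
  β ∈ D.roots ∧ ∃ c : D.I → ℚ, (∀ i, 0 ≤ c i) ∧ β = ∑ i, c i • D.simple i

/-- the length of a Weyl group element -/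
noncomputable def length (g : D.W) : ℕ :=
  sInf {n | ∃ l : List D.I, l.length = n ∧ D.wordProd l = g}

/-- `l` is a reduced word for `g` -/
def IsReduced (l : List D.I) (g : D.W) : Prop :=
  D.wordProd l = g ∧ l.length = D.length g

/-- the number of reduced words of `g` -/
noncomputable def RedCard (g : D.W) : ℕ := Nat.card {l : List D.I // D.IsReduced l g}

/-- the (strong) Bruhat order on the Weyl group -/
def bruhatLE : D.W → D.W → Prop :=
  Relation.ReflTransGen
    (fun a b => (∃ β, D.IsPosRoot β ∧ b = D.srefl β * a) ∧ D.length a < D.length b)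

/-- strict (strong) Bruhat order -/
def bruhatLT (a b : D.W) : Prop := D.bruhatLE a b ∧ a ≠ b

/-- the left weak Bruhat order: `a ≤_L b` iff `ℓ(b a⁻¹) + ℓ(a) = ℓ(b)` -/
def weakLE (a b : D.W) : Prop := D.length (b * a⁻¹) + D.length a = D.length b

/-- the height of a positive root: the sum of its coefficients in the simple roots -/
noncomputable def ht (β : D.V) : ℕ := ∑ i, D.posCoeff β i

/-- an integral weight: the pairings with all positive coroots are integers -/
def IsIntegral (lam : D.V) : Prop :=
  ∀ β, D.IsPosRoot β → ∃ n : ℤ, D.coroot β lam = n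

/-- a dominant integral weight -/
def IsDominant (lam : D.V) : Prop :=
  D.IsIntegral lam ∧ ∀ i, 0 ≤ D.coroot (D.simple i) lam

/-- a pre-dominant integral weight: `⟨λ, β∨⟩ ≥ -1` for all positive roots `β` -/
def IsPreDominant (lam : D.V) : Prop :=
  D.IsIntegral lam ∧ ∀ β, D.IsPosRoot β → -1 ≤ D.coroot β lam

/-- the diagram `D(λ) = {β ∈ R⁺ : ⟨λ, β∨⟩ = -1}` of a pre-dominant weight -/
noncomputable def diagram (lam : D.V) : Finset D.V :=
  D.roots.filter fun β => D.IsPosRoot β ∧ D.coroot β lam = -1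

/-- `IsWeightPath λ [β₁, …, β_r]` says that
`λ = λ₀ →β₁ λ₁ →β₂ ⋯ →β_r λ_r` is a `λ`-path, i.e. each `β_j` is a positive
root, `⟨λ_{j-1}, β_j∨⟩ = -1` and `λ_j = s_{β_j}(λ_{j-1})`. -/
def IsWeightPath : D.V → List D.V → Prop
  | _, [] => True
  | lam, β :: rest =>
      D.IsPosRoot β ∧ D.coroot β lam = -1 ∧
        IsWeightPath (D.act (D.srefl β) lam) rest

/-- the term `1/β₁ ⋅ 1/(β₁+β₂) ⋅ … ⋅ 1/(β₁+⋯+β_r)` attached to a path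
`(β₁, …, β_r)`, computed in a field `F` via a linear embedding `emb`. -/
noncomputable def pathTerm {F : Type} [Field F] [Algebra ℚ F]
    (emb : D.V →ₗ[ℚ] F) (l : List D.V) : F :=
  ∏ j ∈ Finset.range l.length, (emb ((l.take (j + 1)).sum))⁻¹

/-- `w` is a π-minuscule element (in the sense of Peterson). -/
def IsMinuscule (pi : D.V) (w : D.W) : Prop :=
  ∃ l : List D.I, D.IsReduced l w ∧
    ∀ k : Fin l.length,
      D.coroot (D.simple (l.get k)) (D.act (D.wordProd (l.drop (k.val + 1))) pi) = 1

/-- the stabilizer `W_π = Stab_W(π)` of a weight -/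
def stab (pi : D.V) : Subgroup D.W where
  carrier := {g | D.act g pi = pi}
  one_mem' := by simp
  mul_mem' := by
    intro a b ha hb
    simp only [Set.mem_setOf_eq] at *
    calc D.act (a * b) pi = D.act a (D.act b pi) := by rw [map_mul]; rfl
    _ = pi := by rw [hb, ha]
  inv_mem' := by
    intro a ha
    simp only [Set.mem_setOf_eq] at *
    calc D.act a⁻¹ pi = D.act a⁻¹ (D.act a pi) := by rw [ha]
    _ = D.act (a⁻¹ * a) pi := by rw [map_mul]; rfl
    _ = pi := by simp

/-- `u` is the minimal-length representative of its coset `uH` -/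
def IsMinRep (H : Subgroup D.W) (u : D.W) : Prop :=
  ∀ g : D.W, u⁻¹ * g ∈ H → D.length u ≤ D.length g

/-- `a` and `b` lie in the same coset of `H`, i.e. `aH = bH` -/
def SameCoset (H : Subgroup D.W) (a b : D.W) : Prop := a⁻¹ * b ∈ H

/-- `u →β w` in `W^P`: `β` is a positive root, `u, w` are minimal-length
representatives, `s_β w H = u H`, and `u < w` in Bruhat order -/
def Arrow (H : Subgroup D.W) (u w : D.W) (β : D.V) : Prop :=
  D.IsPosRoot β ∧ D.IsMinRep H u ∧ D.IsMinRep H w ∧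
    D.SameCoset H (D.srefl β * w) u ∧ D.bruhatLT u w

/-- `ArrowPath H w [β₁, …, β_r]` encodes a directed path
`x_r →β_r ⋯ → x_1 →β₁ x_0 = w` in the Bruhat graph on `W^P`. -/
def ArrowPath (H : Subgroup D.W) : D.W → List D.V → Prop
  | _, [] => True
  | w, β :: rest => ∃ u, D.Arrow H u w β ∧ ArrowPath H u rest

/-- directed paths as above whose vertices all lie above `v` in Bruhat order -/
def ArrowPathGE (H : Subgroup D.W) (v : D.W) : D.W → List D.V → Prop
  | _, [] => True
  | w, β :: rest => ∃ u, D.Arrow H u w β ∧ D.bruhatLE v u ∧ ArrowPathGE H v u rest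

/-- directed paths from `u` to `w`:
`u = x_r →β_r ⋯ → x_1 →β₁ x_0 = w` encoded by the list `[β₁, …, β_r]`. -/
def ArrowPathFromTo (H : Subgroup D.W) (u : D.W) : D.W → List D.V → Prop
  | w, [] => u = w
  | w, β :: rest => ∃ x, D.Arrow H x w β ∧ ArrowPathFromTo H u x rest

/-- `S(w) = {β ∈ R⁺ : s_β w < w}` -/
noncomputable def Sset (w : D.W) : Finset D.V :=
  D.roots.filter fun β => D.IsPosRoot β ∧ D.bruhatLT (D.srefl β * w) w

/-- `S(w/v) = {β ∈ R⁺ : v ≤ s_β w < w}` -/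
noncomputable def SsetSkew (v w : D.W) : Finset D.V :=
  D.roots.filter fun β =>
    D.IsPosRoot β ∧ D.bruhatLE v (D.srefl β * w) ∧ D.bruhatLT (D.srefl β * w) w

/-- an oriented edge `x → y` in the Bruhat graph of `G/P`: `x, y` are minimal
representatives, `xH < yH`, and `yH = x s_γ H` for some positive root `γ` -/
def GEdge (H : Subgroup D.W) (x y : D.W) : Prop :=
  D.IsMinRep H x ∧ D.IsMinRep H y ∧ D.bruhatLT x y ∧
    ∃ γ, D.IsPosRoot γ ∧ D.SameCoset H (x * D.srefl γ) y

/-- the (unique) positive root `γ` with `yH = x s_γ H` attached to an edge -/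
noncomputable def edgeRoot (H : Subgroup D.W) (x y : D.W) : D.V :=
  if h : ∃ γ, D.IsPosRoot γ ∧ D.SameCoset H (x * D.srefl γ) y then h.choose else 0

/-- `GChainTo H v t [x₁, …, x_r]` encodes a directed path
`v ≤ x_r → ⋯ → x_1 → x_0 = t` in the Bruhat graph of `G/P` -/
def GChainTo (H : Subgroup D.W) (v : D.W) : D.W → List D.W → Prop
  | _, [] => True
  | t, x :: rest => D.GEdge H x t ∧ D.bruhatLE v x ∧ GChainTo H v x rest

/-- the weighted term
`(m_Λ(x_r,x_{r-1})/W_Λ(x_r)) ⋯ (m_Λ(x_1,x_0)/W_Λ(x_1))` of a path in the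
`Λ`-Bruhat graph, computed in a field `F` via a linear embedding `emb`. -/
noncomputable def chainTerm {F : Type} [Field F] [Algebra ℚ F]
    (emb : D.V →ₗ[ℚ] F) (H : Subgroup D.W) (Lam : D.W → D.V) (w : D.W) :
    D.W → List D.W → F
  | _, [] => 1
  | t, x :: rest =>
      algebraMap ℚ F (D.coroot (D.edgeRoot H x t) (Lam x)) *
        (emb (D.act x (Lam x) - D.act w (Lam x)))⁻¹ *
        chainTerm emb H Lam w x rest

/-- the Bruhat order on cosets: `aH ≤ bH` -/
def cosetLE (H : Subgroup D.W) (a b : D.W) : Prop :=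
  ∃ x y, D.SameCoset H a x ∧ D.SameCoset H b y ∧ D.bruhatLE x y

/-- the (standard) parabolic subgroup generated by simple reflections in `J` -/
def parab (J : Set D.I) : Subgroup D.W := Subgroup.closure (D.s '' J)

/-- `X*(T)_P`: integral weights orthogonal to all coroots of `W_P`,
i.e. to `γ∨` for all positive roots `γ` in the span of the simple roots of `P` -/
def OrthWeightP (J : Set D.I) (lam : D.V) : Prop :=
  D.IsIntegral lam ∧
    ∀ γ, D.IsPosRoot γ → γ ∈ Submodule.span ℚ (D.simple '' J) → D.coroot γ lam = 0

/-- an admissible function `Λ : [v,w]^P → X*(T)_P` -/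
def Admissible (J : Set D.I) (v w : D.W) (Lam : D.W → D.V) : Prop :=
  (∀ x, D.IsMinRep (D.parab J) x → D.bruhatLE v x → D.bruhatLE x w →
      D.OrthWeightP J (Lam x)) ∧
  (∀ x, D.IsMinRep (D.parab J) x → D.bruhatLE v x → D.bruhatLE x w → x ≠ w →
      D.act x (Lam x) ≠ D.act w (Lam x))

/-- the subword of `l` with letters at the positions in `S`, in increasing order -/
def subwordF (l : List D.I) (S : Finset (Fin l.length)) : List D.I :=
  ((List.finRange l.length).filter fun j => j ∈ S).map l.get

/-- `β_j = s_{i_1} ⋯ s_{i_{j-1}}(α_{i_j})` attached to a reduced word `l` -/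
noncomputable def refRoot (l : List D.I) (j : Fin l.length) : D.V :=
  D.act (D.wordProd (l.take j.val)) (D.simple (l.get j))

/-- the Weyl group is simply laced: the Cartan pairing is symmetric -/
def SimplyLaced : Prop :=
  ∀ i j, D.coroot (D.simple i) (D.simple j) = D.coroot (D.simple j) (D.simple i)

/-- generating relation of the heap order of the word `l`:
`p_j < p_k` whenever `j < k` and `s_{i_j}`, `s_{i_k}` do not commute -/
def heapCovers (l : List D.I) (j k : Fin l.length) : Prop :=
  (j : ℕ) < (k : ℕ) ∧ D.s (l.get j) * D.s (l.get k) ≠ D.s (l.get k) * D.s (l.get j)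

/-- the heap order of the word `l`: the minimal partial order generated by
`heapCovers` -/
def heapLE (l : List D.I) : Fin l.length → Fin l.length → Prop :=
  Relation.ReflTransGen (D.heapCovers l)

/-- strict heap order -/
def heapLT (l : List D.I) (j k : Fin l.length) : Prop := D.heapLE l j k ∧ j ≠ k

/-- `F` is an order filter of the heap `H(w)` of the word `l` -/
def IsHeapFilter (l : List D.I) (F : Finset (Fin l.length)) : Prop :=
  ∀ j k, j ∈ F → D.heapLE l j k → k ∈ F

/-- `i` and `j` are joined by an edge of the Dynkin diagram -/
def adjDynkin (i j : D.I) : Prop := i ≠ j ∧ D.s i * D.s j ≠ D.s j * D.s i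

/-- an elementary excitation `A ▷ B` of subsets of the heap of the word `l` -/
def Excite (l : List D.I) (A B : Finset (Fin l.length)) : Prop :=
  ∃ p q, D.heapLT l p q ∧ l.get p = l.get q ∧ q ∈ A ∧ p ∈ B ∧
    A.erase q = B.erase p ∧
    (∀ z, D.heapLT l p z → D.heapLT l z q → l.get z ≠ l.get p) ∧
    ∀ u ∈ A, D.heapLE l p u → D.heapLE l u q → ¬ D.adjDynkin (l.get p) (l.get u)

/-- `A` is an excited diagram of `F` in the heap of the word `l`,
i.e. `A ∈ E_{H(w)}(F)` -/
def InExcited (l : List D.I) (F A : Finset (Fin l.length)) : Prop :=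
  Relation.ReflTransGen (D.Excite l) F A

end WeylSetting

namespace WeylSetting

variable (D : WeylSetting)

/-- nonnegative combination of simple roots -/
def Pos (β : D.V) : Prop := ∃ c : D.I → ℚ, (∀ i, 0 ≤ c i) ∧ β = ∑ i, c i • D.simple i

/-- recursive form of the minuscule condition -/
def Mn (pi : D.V) : List D.I → Prop
  | [] => True
  | i :: t => D.coroot (D.simple i) (D.act (D.wordProd t) pi) = 1 ∧ Mn pi t

/-- reducedness of a word -/
def IsRed (t : List D.I) : Prop := ∀ t', D.wordProd t' = D.wordProd t → t.length ≤ t'.length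

theorem act_mul' (g h : D.W) (x : D.V) : D.act (g * h) x = D.act g (D.act h x) := by
  rw [map_mul]; rfl

theorem act_inv_act (g : D.W) (x : D.V) : D.act g⁻¹ (D.act g x) = x := by
  rw [← act_mul']; simp

theorem act_act_inv (g : D.W) (x : D.V) : D.act g (D.act g⁻¹ x) = x := by
  rw [← act_mul']; simp

theorem eq_of_act {a b : D.W} (h : ∀ x, D.act a x = D.act b x) : a = b := by
  have : b⁻¹ * a = 1 := by
    apply D.act_faithful
    intro x
    rw [act_mul', h, act_inv_act]
  rw [inv_mul_eq_one] at this
  exact this.symm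

theorem s_apply (i : D.I) (x : D.V) :
    D.act (D.s i) x = x - D.coroot (D.simple i) x • D.simple i :=
  D.srefl_apply _ (D.simple_mem i) x

theorem s_simple (i : D.I) : D.act (D.s i) (D.simple i) = - D.simple i := by
  rw [s_apply, D.coroot_self _ (D.simple_mem i), two_smul]; abel

theorem s_mul_s (i : D.I) : D.s i * D.s i = 1 := by
  apply D.act_faithful
  intro x
  rw [act_mul', D.s_apply i x, map_sub, map_smul, s_simple, s_apply]
  simp

theorem s_s_act (i : D.I) (x : D.V) : D.act (D.s i) (D.act (D.s i) x) = x := by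
  rw [← act_mul', s_mul_s]; simp

theorem s_inv (i : D.I) : (D.s i)⁻¹ = D.s i := by
  rw [inv_eq_iff_mul_eq_one]; exact D.s_mul_s i

theorem conj (g : D.W) (i j : D.I) (h : D.act g (D.simple i) = D.simple j) :
    g * D.s i = D.s j * g := by
  apply D.eq_of_act
  intro x
  rw [act_mul', act_mul', s_apply, s_apply, map_sub, map_smul, h]
  have := D.coroot_equivariant g _ (D.simple_mem i) x
  rw [h] at this
  rw [this]

theorem wordProd_nil : D.wordProd [] = 1 := rfl

theorem wordProd_cons (i : D.I) (t : List D.I) : D.wordProd (i :: t) = D.s i * D.wordProd t := by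
  simp [wordProd]

theorem wordProd_append (a b : List D.I) : D.wordProd (a ++ b) = D.wordProd a * D.wordProd b := by
  simp [wordProd]

theorem wordProd_reverse (a : List D.I) : D.wordProd a.reverse = (D.wordProd a)⁻¹ := by
  induction a with
  | nil => simp [wordProd_nil]
  | cons i t ih => rw [List.reverse_cons, wordProd_append, ih, wordProd_cons, wordProd_cons,
      wordProd_nil, mul_one, mul_inv_rev, s_inv]

theorem length_le (t : List D.I) : D.length (D.wordProd t) ≤ t.length :=
  Nat.sInf_le ⟨t, rfl, rfl⟩

theorem exists_word (g : D.W) : ∃ t : List D.I, t.length = D.length g ∧ D.wordProd t = g := by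
  have : D.length g ∈ {n | ∃ l : List D.I, l.length = n ∧ D.wordProd l = g} := by
    apply Nat.sInf_mem
    obtain ⟨l, hl⟩ := D.generated g
    exact ⟨l.length, l, rfl, hl.symm⟩
  exact this

theorem length_mul_le (g h : D.W) : D.length (g * h) ≤ D.length g + D.length h := by
  obtain ⟨a, ha, rfl⟩ := D.exists_word g
  obtain ⟨b, hb, rfl⟩ := D.exists_word h
  rw [← wordProd_append, ← ha, ← hb, ← List.length_append]
  exact D.length_le _

theorem IsReduced.isRed {l : List D.I} {g : D.W} (h : D.IsReduced l g) : D.IsRed l := by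
  intro t' ht
  rw [h.2, ← h.1, ← ht]
  exact D.length_le _

theorem IsRed.left {a b : List D.I} (h : D.IsRed (a ++ b)) : D.IsRed a := by
  intro t ht
  have := h (t ++ b) (by rw [wordProd_append, wordProd_append, ht])
  simpa using this

theorem IsRed.right {a b : List D.I} (h : D.IsRed (a ++ b)) : D.IsRed b := by
  intro t ht
  have := h (a ++ t) (by rw [wordProd_append, wordProd_append, ht])
  simpa using this

theorem IsRed.reverse {a : List D.I} (h : D.IsRed a) : D.IsRed a.reverse := by
  intro t ht
  have := h t.reverse (by rw [wordProd_reverse, ht, wordProd_reverse, inv_inv])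
  simpa using this

theorem coef_unique {c d : D.I → ℚ} (h : ∑ i, c i • D.simple i = ∑ i, d i • D.simple i) :
    ∀ i, c i = d i := by
  have h2 : ∑ i, (c i - d i) • D.simple i = 0 := by
    simp only [sub_smul, Finset.sum_sub_distrib, h, sub_self]
  intro i
  have := Fintype.linearIndependent_iff.1 D.simple_indep _ h2 i
  linarith

theorem single_sum (i : D.I) (c : ℚ) :
    c • D.simple i = ∑ j, (if j = i then c else 0) • D.simple j := by
  simp [ite_smul]

theorem root_ne_zero {β : D.V} (h : β ∈ D.roots) : β ≠ 0 := by
  rintro rfl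
  have := D.coroot_self _ h
  simp at this

theorem pos_simple (i : D.I) : D.Pos (D.simple i) :=
  ⟨fun j => if j = i then 1 else 0, fun j => by dsimp only; split_ifs <;> norm_num, by
    rw [← single_sum, one_smul]⟩

theorem not_pos_neg {β : D.V} (hβ : β ∈ D.roots) (h : D.Pos β) (h' : D.Pos (-β)) : False := by
  obtain ⟨c, hc, h1⟩ := h
  obtain ⟨d, hd, h2⟩ := h'
  apply D.root_ne_zero hβ
  have : ∀ i, c i = - d i := by
    apply D.coef_unique
    simp only [neg_smul, Finset.sum_neg_distrib]
    rw [← h1, ← h2, neg_neg]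
  rw [h1]
  apply Finset.sum_eq_zero
  intro i _
  have h3 : c i = 0 := by have := this i; have := hc i; have := hd i; linarith
  rw [h3, zero_smul]

theorem s_pos {β : D.V} (hβ : β ∈ D.roots) (h : D.Pos β) (i : D.I) :
    D.Pos (D.act (D.s i) β) ∨ ∃ c : ℚ, 0 < c ∧ β = c • D.simple i := by
  obtain ⟨c, hc, h1⟩ := h
  by_cases hex : ∃ j, j ≠ i ∧ c j ≠ 0
  · left
    obtain ⟨j, hji, hcj⟩ := hex
    rcases D.root_pos_or_neg _ (D.roots_invariant (D.s i) β hβ) with h2 | ⟨d, hd, h2⟩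
    · exact h2
    · exfalso
      have : ∀ k, c k = (fun k => -d k + (if k = i then D.coroot (D.simple i) β else 0)) k := by
        apply D.coef_unique
        simp only [add_smul, Finset.sum_add_distrib, neg_smul, Finset.sum_neg_distrib]
        rw [← single_sum, ← h2, ← h1, s_apply]
        abel
      have h3 := this j
      simp only [hji, if_false, add_zero] at h3
      have := hc j
      have := hd j
      apply hcj
      linarith
  · right
    push Not at hex
    have h2 : β = c i • D.simple i := by
      rw [h1]
      rw [Finset.sum_eq_single i]
      · intro b _ hb
        rw [hex b hb, zero_smul]
      · simp
    refine ⟨c i, lt_of_le_of_ne (hc i) ?_, h2⟩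
    intro h0
    apply D.root_ne_zero hβ
    rw [h2, ← h0, zero_smul]

theorem nat_coef {c : ℚ} {i : D.I} (hc : 0 < c) (h : c • D.simple i ∈ D.roots) :
    ∃ n : ℕ, c = n := by
  have h1 := D.posCoeff_spec _ h ⟨fun j => if j = i then c else 0,
    fun j => by dsimp only; split_ifs <;> [exact hc.le; rfl], D.single_sum i c⟩
  have h2 : (if i = i then c else 0) = (D.posCoeff (c • D.simple i) i : ℚ) :=
    D.coef_unique (c := fun j => if j = i then c else 0)
      (d := fun j => (D.posCoeff (c • D.simple i) j : ℚ)) ((D.single_sum i c).symm.trans h1) i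
  exact ⟨_, by simpa using h2⟩

theorem orbit_coef {c : ℚ} {i j : D.I} {g : D.W} (hc : 0 < c)
    (h : D.act g (D.simple i) = c • D.simple j) : c = 1 := by
  have h1 := D.roots_invariant g _ (D.simple_mem i)
  rw [h] at h1
  obtain ⟨n, hn⟩ := D.nat_coef hc h1
  have h2 : D.act g⁻¹ (D.simple j) = c⁻¹ • D.simple i := by
    rw [← D.act_inv_act g (D.simple i), h, map_smul, smul_smul, inv_mul_cancel₀ hc.ne', one_smul]
  have h3 := D.roots_invariant g⁻¹ _ (D.simple_mem j)
  rw [h2] at h3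
  -- c⁻¹ simple i is a root
  obtain ⟨m, hm⟩ := D.nat_coef (inv_pos.2 hc) h3
  have h4 : (n : ℚ) * m = 1 := by rw [← hn, ← hm, mul_inv_cancel₀ hc.ne']
  have h5 : n * m = 1 := by exact_mod_cast h4
  rw [hn, Nat.eq_one_of_mul_eq_one_right h5]; simp

theorem inv_step (t : List D.I) (g : D.W) (i : D.I) (hp : D.Pos (D.act g (D.simple i)))
    (hn : D.Pos (-(D.act (D.wordProd t) (D.act g (D.simple i))))) :
    ∃ t1 j t2, t = t1 ++ j :: t2 ∧ D.act (D.wordProd t2) (D.act g (D.simple i)) = D.simple j := by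
  induction t with
  | nil =>
    exfalso
    rw [wordProd_nil, map_one] at hn
    exact D.not_pos_neg (D.roots_invariant g _ (D.simple_mem i)) hp hn
  | cons j t ih =>
    have hr := D.roots_invariant (D.wordProd t) _ (D.roots_invariant g _ (D.simple_mem i))
    rcases D.root_pos_or_neg _ hr with h | h
    · rcases D.s_pos hr h j with h2 | ⟨c, hc, h2⟩
      · exfalso
        rw [wordProd_cons, act_mul'] at hn
        exact D.not_pos_neg (D.roots_invariant _ _ hr) h2 hn
      · have h3 := h2
        rw [← act_mul'] at h3
        have := D.orbit_coef hc h3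
        subst this
        exact ⟨[], j, t, rfl, by rw [h2, one_smul]⟩
    · obtain ⟨t1, k, t2, h1, h2⟩ := ih h
      exact ⟨j :: t1, k, t2, by rw [h1]; rfl, h2⟩

theorem red_pos {t : List D.I} {i : D.I} (h : D.IsRed (t ++ [i])) :
    D.Pos (D.act (D.wordProd t) (D.simple i)) := by
  rcases D.root_pos_or_neg _ (D.roots_invariant (D.wordProd t) _ (D.simple_mem i)) with h1 | h1
  · exact h1
  exfalso
  obtain ⟨t1, j, t2, h2, h3⟩ := D.inv_step t 1 i (by simpa using D.pos_simple i) (by simpa [Pos] using h1)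
  simp only [map_one] at h3
  have h4 := D.conj _ _ _ h3
  have := h (t1 ++ t2) (by
    rw [h2]
    simp only [wordProd_append, wordProd_cons, wordProd_nil, mul_one, mul_assoc]
    rw [h4, ← mul_assoc (D.s j), s_mul_s, one_mul])
  rw [h2] at this
  simp at this

theorem red_pos_left {t : List D.I} {i : D.I} (h : D.IsRed (i :: t)) :
    D.Pos (D.act (D.wordProd t)⁻¹ (D.simple i)) := by
  rw [← wordProd_reverse]
  apply red_pos
  simpa using h.reverse

theorem Mn_split {pi : D.V} {l : List D.I} :
    D.Mn pi l ↔ ∀ t1 j t2, l = t1 ++ j :: t2 →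
      D.coroot (D.simple j) (D.act (D.wordProd t2) pi) = 1 := by
  induction l with
  | nil => simp [Mn]
  | cons i t ih =>
    rw [Mn, ih]
    constructor
    · rintro ⟨h1, h2⟩ t1 j t2 h
      cases t1 with
      | nil => simp at h; rw [← h.1, ← h.2]; exact h1
      | cons a t1 => simp at h; exact h2 _ _ _ h.2
    · intro h
      exact ⟨h [] i t rfl, fun t1 j t2 h' => h (i :: t1) j t2 (by rw [h']; rfl)⟩

theorem Mn_fin {pi : D.V} {l : List D.I} :
    D.Mn pi l ↔ ∀ k : Fin l.length,
      D.coroot (D.simple (l.get k)) (D.act (D.wordProd (l.drop (k.val + 1))) pi) = 1 := by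
  induction l with
  | nil => simp [Mn]
  | cons i t ih =>
    rw [Mn, ih]
    constructor
    · rintro ⟨h1, h2⟩ k
      refine Fin.cases ?_ ?_ k
      · exact h1
      · intro k; exact h2 k
    · intro h
      exact ⟨h 0, fun k => h k.succ⟩

theorem Mn_indep {pi : D.V} {l1 l2 : List D.I} (h : D.wordProd l1 = D.wordProd l2)
    (h2 : D.IsRed l2) (hm : D.Mn pi l1) : D.Mn pi l2 := by
  rw [Mn_split] at hm ⊢
  intro t1 j t2 hl
  have hr : D.IsRed (t1 ++ [j] ++ t2) := by rw [hl] at h2; simpa using h2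
  have hr2 : D.IsRed (j :: t2) := by rw [hl] at h2; exact IsRed.right D h2
  have p1 := D.red_pos_left hr2
  have p2 := D.red_pos (IsRed.left D hr)
  obtain ⟨a, k, b, h3, h4⟩ := D.inv_step l1 (D.wordProd t2)⁻¹ j p1 (by
    rw [h, hl, wordProd_append, wordProd_cons, act_mul', act_mul', act_act_inv, s_simple,
      map_neg, neg_neg]
    exact p2)
  have h5 := hm a k b h3
  rw [← h4, D.coroot_equivariant _ _ (D.roots_invariant _ _ (D.simple_mem j)),
    ← D.coroot_equivariant (D.wordProd t2) _ (D.roots_invariant _ _ (D.simple_mem j)),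
    act_act_inv] at h5
  exact h5

/-- Cartan integers -/
def ca (i j : D.I) : ℚ := D.coroot (D.simple i) (D.simple j)

theorem ca_self (i : D.I) : D.ca i i = 2 := D.coroot_self _ (D.simple_mem i)

theorem ca_nonpos {i j : D.I} (h : j ≠ i) : D.ca i j ≤ 0 := by
  rcases D.s_pos (D.simple_mem j) (D.pos_simple j) i with ⟨c, hc, h1⟩ | ⟨c, hc, h1⟩
  · rw [s_apply] at h1
    have : ∀ k, (fun k => (if k = j then 1 else 0) + (if k = i then - D.ca i j else 0)) k = c k := by
      apply D.coef_unique
      simp only [add_smul, Finset.sum_add_distrib]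
      rw [← single_sum, ← single_sum, ← h1, one_smul, neg_smul, ca]
      abel
    have h2 := this i
    simp only [h.symm, if_false, if_true, zero_add] at h2
    have := hc i
    linarith
  · exfalso
    have h2 : (1:ℚ) • D.simple j = c • D.simple i := by rw [one_smul, h1]
    rw [single_sum, single_sum] at h2
    have := D.coef_unique h2 j
    simp [h] at this

theorem ca_of_commute {i j : D.I} (h : j ≠ i) (hc : D.s i * D.s j = D.s j * D.s i) :
    D.ca i j = 0 := by
  have h1 : D.act (D.s i * D.s j) (D.simple j) = D.act (D.s j * D.s i) (D.simple j) := by rw [hc]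
  rw [act_mul', act_mul', s_simple, map_neg, D.s_apply i, map_sub, s_simple, map_smul,
    D.s_apply j, ← ca, ← ca] at h1
  have : ∀ k, (fun k => (if k = i then 2 * D.ca i j else 0)
      + (if k = j then - (D.ca i j * D.ca j i) else 0)) k = (fun _ => 0) k := by
    apply D.coef_unique
    simp only [add_smul, Finset.sum_add_distrib]
    rw [← single_sum, ← single_sum]
    have h2 := sub_eq_zero.2 h1
    simp only [zero_smul, Finset.sum_const_zero]
    rw [← h2]
    module
  have h3 := this i
  simp [h.symm] at h3
  exact h3

theorem ca_neg {i j : D.I} (hc : D.s i * D.s j ≠ D.s j * D.s i) : D.ca i j ≤ -1 := by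
  have hne : j ≠ i := by rintro rfl; exact hc rfl
  obtain ⟨n, hn⟩ := D.crystallographic _ (D.simple_mem i) _ (D.simple_mem j)
  have h0 := D.ca_nonpos hne
  have h1 : D.ca i j ≠ 0 := by
    intro h
    apply hc
    apply D.conj
    rw [s_apply, ← ca, h, zero_smul, sub_zero]
  have h2 : D.ca i j = n := hn
  rw [h2] at h0 h1 ⊢
  have : n ≤ 0 := by exact_mod_cast h0
  have : n ≠ 0 := by exact_mod_cast h1
  have : n ≤ -1 := by omega
  exact_mod_cast this


theorem Mn_act {ι : Type} [DecidableEq ι] (c : ι → D.I) (pi : D.V) (L : List ι) (hL : L.Nodup)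
    (h : D.Mn pi (L.map c)) :
    D.act (D.wordProd (L.map c)) pi = pi - ∑ j ∈ L.toFinset, D.simple (c j) := by
  induction L with
  | nil => simp [wordProd_nil]
  | cons k L ih =>
    rw [List.nodup_cons] at hL
    rw [List.map_cons, Mn] at h
    rw [List.map_cons, wordProd_cons, act_mul', s_apply, h.1, ih hL.2 h.2, List.toFinset_cons,
      Finset.sum_insert (by simpa using hL.1), one_smul]
    abel

theorem Mn_pos {ι : Type} [LinearOrder ι] (c : ι → D.I) (pi : D.V) (L : List ι)
    (hL : L.Pairwise (· < ·)) :
    D.Mn pi (L.map c) ↔ ∀ k ∈ L, D.coroot (D.simple (c k)) pi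
      - ∑ j ∈ L.toFinset with k < j, D.ca (c k) (c j) = 1 := by
  induction L with
  | nil => simp [Mn]
  | cons k L ih =>
    have hnd : (k :: L).Nodup := hL.imp (fun h => ne_of_lt h)
    rw [List.pairwise_cons] at hL
    rw [List.map_cons, Mn, List.forall_mem_cons]
    have e1 : (∀ m ∈ L, D.coroot (D.simple (c m)) pi
      - ∑ j ∈ (k :: L).toFinset with m < j, D.ca (c m) (c j) = 1) ↔
      (∀ m ∈ L, D.coroot (D.simple (c m)) pi
      - ∑ j ∈ L.toFinset with m < j, D.ca (c m) (c j) = 1) := by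
      apply forall₂_congr
      intro m hm
      have : (k :: L).toFinset.filter (fun j => m < j) = L.toFinset.filter (fun j => m < j) := by
        ext j
        have := hL.1 m hm
        simp only [List.toFinset_cons, Finset.mem_filter, Finset.mem_insert]
        constructor
        · rintro ⟨rfl | h, h2⟩
          · exact absurd h2 (not_lt.2 this.le)
          · exact ⟨h, h2⟩
        · rintro ⟨h, h2⟩; exact ⟨Or.inr h, h2⟩
      rw [this]
    rw [e1, ← ih hL.2]
    apply and_congr_left
    intro hm
    rw [D.Mn_act c pi L (List.nodup_cons.1 hnd).2 hm, map_sub, map_sum]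
    have : (k :: L).toFinset.filter (fun j => k < j) = L.toFinset := by
      ext j
      simp only [List.toFinset_cons, Finset.mem_filter, Finset.mem_insert, List.mem_toFinset]
      constructor
      · rintro ⟨rfl | h, h2⟩
        · exact absurd h2 (lt_irrefl _)
        · exact h
      · intro h; exact ⟨Or.inr h, hL.1 j h⟩
    rw [this]
    rfl

theorem sw_pairwise (l : List D.I) (S : Finset (Fin l.length)) :
    ((List.finRange l.length).filter fun j => j ∈ S).Pairwise (· < ·) :=
  (List.pairwise_lt_finRange _).filter _

theorem sw_toFinset (l : List D.I) (S : Finset (Fin l.length)) :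
    ((List.finRange l.length).filter fun j => j ∈ S).toFinset = S := by
  ext j; simp

theorem sw_length (l : List D.I) (S : Finset (Fin l.length)) :
    (D.subwordF l S).length = S.card := by
  conv_rhs => rw [← D.sw_toFinset l S]
  rw [List.toFinset_card_of_nodup ((D.sw_pairwise l S).imp (fun h => ne_of_lt h)), subwordF,
    List.length_map]

theorem sw_univ (l : List D.I) : D.subwordF l Finset.univ = l := by
  simp [subwordF, ← List.ofFn_eq_map]

theorem Mn_sw (l : List D.I) (S : Finset (Fin l.length)) (pi : D.V) :
    D.Mn pi (D.subwordF l S) ↔ ∀ k ∈ S, D.coroot (D.simple (l.get k)) pi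
      - ∑ j ∈ S with k < j, D.ca (l.get k) (l.get j) = 1 := by
  rw [subwordF, D.Mn_pos _ _ _ (D.sw_pairwise l S), D.sw_toFinset l S]
  simp

theorem Mn_sw_act (l : List D.I) (S : Finset (Fin l.length)) (pi : D.V)
    (h : D.Mn pi (D.subwordF l S)) :
    D.act (D.wordProd (D.subwordF l S)) pi = pi - ∑ j ∈ S, D.simple (l.get j) := by
  have := D.Mn_act _ _ _ ((D.sw_pairwise l S).imp (fun h => ne_of_lt h)) h
  rw [D.sw_toFinset l S] at this
  exact this

theorem prod_split {ι G : Type} [Group G] (f : ι → G) (P : ι → Prop) (L : List ι)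
    (h : L.Pairwise (fun a b => P a → ¬ P b → Commute (f a) (f b))) :
    (L.map f).prod = ((L.filter (fun j => ¬ P j)).map f).prod * ((L.filter (fun j => P j)).map f).prod := by
  induction L with
  | nil => simp
  | cons a L ih =>
    rw [List.pairwise_cons] at h
    rw [List.map_cons, List.prod_cons, ih h.2]
    by_cases ha : P a
    · have : Commute (f a) ((L.filter (fun j => ¬ P j)).map f).prod := by
        apply Commute.list_prod_right
        intro x hx
        simp only [List.mem_map, List.mem_filter, decide_eq_true_eq] at hx
        obtain ⟨b, ⟨hb, hPb⟩, rfl⟩ := hx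
        exact h.1 b hb ha hPb
      rw [List.filter_cons_of_neg (by simpa using ha), List.filter_cons_of_pos (by simpa using ha),
        List.map_cons, List.prod_cons, ← mul_assoc, ← mul_assoc, this.eq]
    · rw [List.filter_cons_of_pos (by simpa using ha), List.filter_cons_of_neg (by simpa using ha),
        List.map_cons, List.prod_cons, mul_assoc]

theorem filter_comm (l : List D.I) (F : Finset (Fin l.length)) (hf : D.IsHeapFilter l F)
    {j k : Fin l.length} (hjk : j < k) (hj : j ∈ F) (hk : k ∉ F) :
    D.s (l.get j) * D.s (l.get k) = D.s (l.get k) * D.s (l.get j) := by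
  by_contra h
  exact hk (hf j k hj (Relation.ReflTransGen.single ⟨hjk, h⟩))

theorem sw_split (l : List D.I) (F : Finset (Fin l.length)) (hf : D.IsHeapFilter l F) :
    D.wordProd l = D.wordProd (D.subwordF l Fᶜ) * D.wordProd (D.subwordF l F) := by
  have := prod_split (fun j => D.s (l.get j)) (fun j => j ∈ F) (List.finRange l.length)
    ((List.pairwise_lt_finRange _).imp (fun {a b} hab ha hb => D.filter_comm l F hf hab ha hb))
  conv_lhs => rw [← D.sw_univ l]
  simp only [wordProd, subwordF, List.map_map]
  simp only [Finset.mem_univ, decide_true, List.filter_true, Finset.mem_compl, Function.comp_def]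
  convert this using 4 <;> (congr; funext j; congr)

theorem heapLE_le {l : List D.I} {j k : Fin l.length} (h : D.heapLE l j k) : j ≤ k := by
  induction h with
  | refl => exact le_rfl
  | tail _ h ih => exact ih.trans (le_of_lt h.1)

theorem heapLT_lt {l : List D.I} {j k : Fin l.length} (h : D.heapLT l j k) : j < k :=
  lt_of_le_of_ne (D.heapLE_le h.1) h.2

/-- the numerical form of the minuscule condition for the word `l` -/
def NumCond (l : List D.I) (pi : D.V) : Prop :=
  ∀ k, D.coroot (D.simple (l.get k)) pi - ∑ j with k < j, D.ca (l.get k) (l.get j) = 1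

theorem between {l : List D.I} {pi : D.V} (h : D.NumCond l pi) {p q : Fin l.length}
    (hpq : p < q) (hc : l.get p = l.get q) :
    ∑ j with p < j ∧ j < q, D.ca (l.get p) (l.get j) = -2 := by
  have h1 := h p
  have h2 := h q
  rw [← hc] at h2
  have e : (Finset.univ.filter (fun j => p < j)) =
      (Finset.univ.filter (fun j => p < j ∧ j < q)) ∪ insert q (Finset.univ.filter (fun j => q < j)) := by
    ext j
    simp only [Finset.mem_filter, Finset.mem_univ, true_and, Finset.mem_union, Finset.mem_insert]
    constructor
    · intro hj
      rcases lt_trichotomy j q with h | h | h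
      · exact Or.inl ⟨hj, h⟩
      · exact Or.inr (Or.inl h)
      · exact Or.inr (Or.inr h)
    · rintro (h | rfl | h)
      · exact h.1
      · exact hpq
      · exact hpq.trans h
  rw [e, Finset.sum_union, Finset.sum_insert (by simp), ← hc, ca_self] at h1
  · linarith
  · rw [Finset.disjoint_left]
    intro j hj hj2
    simp only [Finset.mem_filter, Finset.mem_univ, true_and, Finset.mem_insert] at hj hj2
    rcases hj2 with rfl | h
    · exact lt_irrefl _ hj.2
    · exact lt_asymm h hj.2

theorem same_color {l : List D.I} {pi : D.V} (h : D.NumCond l pi) {p q : Fin l.length}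
    (hpq : p < q) (hc : l.get p = l.get q) : D.heapLE l p q := by
  have h1 := D.between h hpq hc
  by_contra hcon
  have : 0 ≤ ∑ j with p < j ∧ j < q, D.ca (l.get p) (l.get j) := by
    apply Finset.sum_nonneg
    intro j hj
    simp only [Finset.mem_filter, Finset.mem_univ, true_and] at hj
    by_cases hs : l.get j = l.get p
    · rw [hs, ca_self]; norm_num
    · by_cases hcm : D.s (l.get p) * D.s (l.get j) = D.s (l.get j) * D.s (l.get p)
      · rw [D.ca_of_commute hs hcm]
      · exfalso
        apply hcon
        refine (Relation.ReflTransGen.single (b := j) ⟨hj.1, hcm⟩).tail ⟨hj.2, ?_⟩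
        rw [← hc]
        exact fun h => hcm h.symm
  linarith

/-- elements outside the filter above an element of the filter do not interact -/
theorem ca_filter {l : List D.I} {pi : D.V} (h : D.NumCond l pi) {F : Finset (Fin l.length)}
    (hf : D.IsHeapFilter l F) {j k : Fin l.length} (hjk : j < k) (hj : j ∈ F) (hk : k ∉ F) :
    D.ca (l.get j) (l.get k) = 0 ∧ D.ca (l.get k) (l.get j) = 0 := by
  have h1 := D.filter_comm l F hf hjk hj hk
  have h2 : l.get j ≠ l.get k := fun hc => hk (hf j k hj (D.same_color h hjk hc))
  exact ⟨D.ca_of_commute h2.symm h1, D.ca_of_commute h2 h1.symm⟩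

theorem F_num {l : List D.I} {pi : D.V} (h : D.NumCond l pi) {F : Finset (Fin l.length)}
    (hf : D.IsHeapFilter l F) : D.Mn pi (D.subwordF l F) := by
  rw [Mn_sw]
  intro k hk
  rw [← h k]
  congr 1
  apply Finset.sum_subset
  · intro j hj; simp at hj ⊢; exact hj.2
  · intro j hj hj2
    simp only [Finset.mem_filter, Finset.mem_univ, true_and] at hj hj2
    exact (D.ca_filter h hf hj hk (fun hF => hj2 ⟨hF, hj⟩)).1

theorem Fc_num {l : List D.I} {pi : D.V} (h : D.NumCond l pi) {F : Finset (Fin l.length)}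
    (hf : D.IsHeapFilter l F) :
    D.Mn (pi - ∑ j ∈ F, D.simple (l.get j)) (D.subwordF l Fᶜ) := by
  rw [Mn_sw]
  intro k hk
  rw [Finset.mem_compl] at hk
  rw [← h k, map_sub, map_sum, sub_sub]
  congr 1
  have e1 : ∑ j ∈ F, D.coroot (D.simple (l.get k)) (D.simple (l.get j)) =
      ∑ j ∈ F with k < j, D.ca (l.get k) (l.get j) := by
    symm
    apply Finset.sum_subset (Finset.filter_subset _ _)
    intro j hj hj2
    simp only [Finset.mem_filter, not_and, not_lt] at hj2
    have hne : j ≠ k := by rintro rfl; exact hk hj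
    exact (D.ca_filter h hf (lt_of_le_of_ne (hj2 hj) hne) hj hk).2
  rw [e1, ← Finset.sum_union]
  · congr 1
    rw [← Finset.filter_union, Finset.union_compl]
  · apply Finset.disjoint_filter_filter
    exact disjoint_compl_right

theorem cut {l : List D.I} {pi : D.V} (h : D.NumCond l pi) {F : Finset (Fin l.length)}
    (hf : D.IsHeapFilter l F) {p q : Fin l.length} (hc : l.get p = l.get q) (hq : q ∈ F) :
    ∑ j ∈ Fᶜ with p < j ∧ j < q, D.ca (l.get p) (l.get j) =
      ∑ j ∈ Fᶜ with p < j, D.ca (l.get p) (l.get j) := by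
      apply Finset.sum_subset
      · intro j hj; simp only [Finset.mem_filter] at hj ⊢; exact ⟨hj.1, hj.2.1⟩
      · intro j hj hj2
        simp only [Finset.mem_filter, Finset.mem_compl, not_and, not_lt] at hj hj2
        have hne : j ≠ q := by rintro rfl; exact hj.1 hq
        have := hj2 hj.1 hj.2
        rw [hc]
        exact (D.ca_filter h hf (lt_of_le_of_ne this hne.symm) hq hj.1).1

theorem sum_anti {ι : Type} [DecidableEq ι] {f : ι → ℚ} {s t : Finset ι} (h : s ⊆ t)
    (hf : ∀ i ∈ t, f i ≤ 0) : ∑ i ∈ t, f i ≤ ∑ i ∈ s, f i := by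
  have := Finset.sum_le_sum_of_subset_of_nonneg (f := fun i => - f i) h
    (fun i hi _ => by have := hf i hi; linarith)
  simp only [Finset.sum_neg_distrib] at this
  linarith

theorem excite_neg {l : List D.I} {pi : D.V} (h : D.NumCond l pi) {F B : Finset (Fin l.length)}
    (hf : D.IsHeapFilter l F) (he : D.Excite l F B) :
    B ≠ F ∧ ∃ k ∉ F, D.coroot (D.simple (l.get k)) (pi - ∑ j ∈ F, D.simple (l.get j)) < 0 := by
  obtain ⟨p, q, hpq, hc, hq, hpB, hE, hz, hu⟩ := he
  have hlt := D.heapLT_lt hpq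
  have hpF : p ∉ F := by
    intro hp
    have : p ∈ F.erase q := Finset.mem_erase.2 ⟨hpq.2, hp⟩
    rw [hE] at this
    simp at this
  refine ⟨fun hBF => hpF (hBF ▸ hpB), p, hpF, ?_⟩
  have h1 := (D.Mn_sw l Fᶜ _).1 (D.Fc_num h hf) p (Finset.mem_compl.2 hpF)
  have h2 := D.between h hlt hc
  have h3 : ∑ j ∈ Fᶜ with p < j, D.ca (l.get p) (l.get j) = -2 := by
    have ea := D.cut h hf hc hq
    rw [← ea, ← h2]
    apply Finset.sum_subset
    · intro j hj; simp only [Finset.mem_filter] at hj ⊢; exact ⟨Finset.mem_univ _, hj.2⟩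
    · intro j hj hj2
      simp only [Finset.mem_filter, Finset.mem_compl, Finset.mem_univ, true_and, not_and] at hj hj2
      have hjF : j ∈ F := by by_contra hjF; exact hj2 hjF hj.1 hj.2
      have hne : l.get j ≠ l.get p := by
        intro hjp
        refine hz j ⟨D.same_color h hj.1 hjp.symm, hj.1.ne⟩
          ⟨D.same_color h hj.2 (hjp.trans hc), hj.2.ne⟩ hjp
      apply D.ca_of_commute hne
      by_contra hcm
      refine hu j hjF (Relation.ReflTransGen.single ⟨hj.1, hcm⟩)
        (Relation.ReflTransGen.single ⟨hj.2, ?_⟩) ⟨hne.symm, hcm⟩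
      rw [← hc]
      exact fun h => hcm h.symm
  rw [h3] at h1
  linarith

theorem neg_excite {l : List D.I} {pi : D.V} (hpi : D.IsDominant pi) (h : D.NumCond l pi)
    {F : Finset (Fin l.length)} (hf : D.IsHeapFilter l F) {k : Fin l.length} (hk : k ∉ F)
    (hneg : D.coroot (D.simple (l.get k)) (pi - ∑ j ∈ F, D.simple (l.get j)) < 0) :
    ∃ B, D.Excite l F B := by
  have hneT : (Fᶜ.filter (fun j => l.get j = l.get k)).Nonempty := ⟨k, by simp [hk]⟩
  obtain ⟨p, hpm, hpmax⟩ := Finset.exists_max_image _ (fun j => j) hneT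
  simp only [Finset.mem_filter, Finset.mem_compl] at hpm hpmax
  obtain ⟨hpF, hpk⟩ := hpm
  rw [← hpk] at hneg hpmax
  have h1 := (D.Mn_sw l Fᶜ _).1 (D.Fc_num h hf) p (Finset.mem_compl.2 hpF)
  have hsum : ∑ j ∈ Fᶜ with p < j, D.ca (l.get p) (l.get j) < -1 := by linarith
  by_cases hq : (F.filter (fun j => l.get j = l.get p)).Nonempty
  · obtain ⟨q, hqm, hqmin⟩ := Finset.exists_min_image _ (fun j => j) hq
    simp only [Finset.mem_filter] at hqm hqmin
    obtain ⟨hqF, hqp⟩ := hqm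
    have hne : p ≠ q := by rintro rfl; exact hpF hqF
    have hlt : p < q := by
      by_contra hcon
      have : q < p := lt_of_le_of_ne (not_lt.1 hcon) hne.symm
      exact hpF (hf q p hqF (D.same_color h this hqp))
    have h2 := D.between h hlt hqp.symm
    have hcol : ∀ j, p < j → j < q → l.get j ≠ l.get p := by
      intro j hj1 hj2 hc
      by_cases hjF : j ∈ F
      · exact absurd hj2 (not_lt.2 (hqmin j ⟨hjF, hc⟩))
      · exact absurd hj1 (not_lt.2 (hpmax j ⟨hjF, hc⟩))
    refine ⟨insert p (F.erase q), p, q, ⟨D.same_color h hlt hqp.symm, hne⟩, hqp.symm, hqF,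
      Finset.mem_insert_self _ _, ?_, ?_, ?_⟩
    · rw [Finset.erase_insert]
      simp [hpF]
    · intro z hz1 hz2
      exact hcol z (D.heapLT_lt hz1) (D.heapLT_lt hz2)
    · intro u huF hpu huq hadj
      have hpu' : p < u := lt_of_le_of_ne (D.heapLE_le hpu) (by rintro rfl; exact hpF huF)
      have huq' : u < q := lt_of_le_of_ne (D.heapLE_le huq) (by
        rintro rfl; exact hadj.1 hqp.symm)
      have h3 := D.ca_neg hadj.2
      have h4 : ∑ j with p < j ∧ j < q, D.ca (l.get p) (l.get j) ≤
          ∑ j ∈ insert u (Fᶜ.filter (fun j => p < j ∧ j < q)), D.ca (l.get p) (l.get j) := by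
        apply sum_anti
        · intro j hj
          simp only [Finset.mem_filter, Finset.mem_insert, Finset.mem_univ, true_and] at hj ⊢
          rcases hj with rfl | hj
          · exact ⟨hpu', huq'⟩
          · exact hj.2
        · intro j hj
          simp only [Finset.mem_filter, Finset.mem_univ, true_and] at hj
          exact D.ca_nonpos (hcol j hj.1 hj.2)
      have h5 := D.cut h hf hqp.symm hqF
      rw [Finset.sum_insert (by simp [huF])] at h4
      linarith
  · exfalso
    have h2 := h p
    have h3 := hpi.2 (l.get p)
    have hcol : ∀ j, p < j → l.get j ≠ l.get p := by
      intro j hj1 hc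
      by_cases hjF : j ∈ F
      · exact hq ⟨j, Finset.mem_filter.2 ⟨hjF, hc⟩⟩
      · exact absurd hj1 (not_lt.2 (hpmax j ⟨hjF, hc⟩))
    have h4 : ∑ j with p < j, D.ca (l.get p) (l.get j) ≤
        ∑ j ∈ Fᶜ with p < j, D.ca (l.get p) (l.get j) := by
      apply sum_anti
      · intro j hj
        simp only [Finset.mem_filter, Finset.mem_univ, true_and] at hj ⊢
        exact hj.2
      · intro j hj
        simp only [Finset.mem_filter, Finset.mem_univ, true_and] at hj
        exact D.ca_nonpos (hcol j hj)
    linarith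


theorem Mn_diff {a b : D.V} {t : List D.I} (ha : D.Mn a t) (hb : D.Mn b t) :
    D.act (D.wordProd t) (a - b) = a - b ∧ ∀ i ∈ t, D.coroot (D.simple i) (a - b) = 0 := by
  induction t with
  | nil => simp [wordProd_nil]
  | cons i t ih =>
    obtain ⟨h1, h2⟩ := ih ha.2 hb.2
    have h3 : D.coroot (D.simple i) (a - b) = 0 := by
      rw [← h1, map_sub, map_sub, ha.1, hb.1, sub_self]
    refine ⟨?_, ?_⟩
    · rw [wordProd_cons, act_mul', h1, s_apply, h3, zero_smul, sub_zero]
    · intro k hk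
      rcases List.mem_cons.1 hk with rfl | hk
      · exact h3
      · exact h2 k hk

theorem Mn_add {a b : D.V} {t : List D.I} (ha : D.Mn a t)
    (hb : ∀ i ∈ t, D.coroot (D.simple i) b = 0) :
    D.act (D.wordProd t) b = b ∧ D.Mn (a + b) t := by
  induction t with
  | nil => simp [wordProd_nil, Mn]
  | cons i t ih =>
    obtain ⟨h1, h2⟩ := ih ha.2 (fun k hk => hb k (List.mem_cons_of_mem _ hk))
    have h3 := hb i List.mem_cons_self
    refine ⟨?_, ?_, h2⟩
    · rw [wordProd_cons, act_mul', h1, s_apply, h3, zero_smul, sub_zero]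
    · rw [map_add, map_add, h1, h3, ha.1, add_zero]

theorem coroot_sum_stable (S : Finset D.V) (i : D.I) (h : ∀ β ∈ S, D.act (D.s i) β ∈ S) :
    D.coroot (D.simple i) (∑ β ∈ S, β) = 0 := by
  have h1 : D.act (D.s i) (∑ β ∈ S, β) = ∑ β ∈ S, β := by
    rw [map_sum]
    exact Finset.sum_nbij' (fun β => D.act (D.s i) β) (fun β => D.act (D.s i) β) h h
      (fun β _ => D.s_s_act i β) (fun β _ => D.s_s_act i β) (fun β _ => rfl)
  rw [s_apply, sub_eq_self, smul_eq_zero] at h1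
  rcases h1 with h1 | h1
  · exact h1
  · exact absurd h1 (D.root_ne_zero (D.simple_mem i))

/-- the positive roots -/
noncomputable def posR : Finset D.V := D.roots.filter D.Pos

theorem rho_pos (i : D.I) : 0 < D.coroot (D.simple i) (∑ β ∈ D.posR, β) := by
  rw [← Finset.sum_filter_add_sum_filter_not D.posR (fun β => ∃ c : ℚ, 0 < c ∧ β = c • D.simple i),
    map_add]
  rw [D.coroot_sum_stable (D.posR.filter fun β => ¬ ∃ c : ℚ, 0 < c ∧ β = c • D.simple i), add_zero,
    map_sum]
  · apply Finset.sum_pos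
    · intro β hβ
      obtain ⟨c, hc, rfl⟩ := (Finset.mem_filter.1 hβ).2
      rw [map_smul, D.coroot_self _ (D.simple_mem i), smul_eq_mul]
      linarith
    · exact ⟨D.simple i, Finset.mem_filter.2 ⟨Finset.mem_filter.2 ⟨D.simple_mem i, D.pos_simple i⟩,
        1, one_pos, (one_smul _ _).symm⟩⟩
  · intro β hβ
    obtain ⟨hβ, hn⟩ := Finset.mem_filter.1 hβ
    obtain ⟨hr, hp⟩ := Finset.mem_filter.1 hβ
    have h1 := (D.s_pos hr hp i).resolve_right hn
    refine Finset.mem_filter.2 ⟨Finset.mem_filter.2 ⟨D.roots_invariant _ _ hr, h1⟩, ?_⟩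
    rintro ⟨c, hc, h2⟩
    have h3 : β = -(c • D.simple i) := by
      rw [← D.s_s_act i β, h2, map_smul, s_simple, smul_neg]
    apply D.not_pos_neg hr hp
    rw [h3, neg_neg]
    rw [h2] at h1
    exact h1

/-- membership in the span of the simple roots of `J` -/
def InSp (J : Set D.I) (β : D.V) : Prop := ∃ c : D.I → ℚ, (∀ i ∉ J, c i = 0) ∧ β = ∑ i, c i • D.simple i

theorem InSp.refl {J : Set D.I} {β : D.V} {i : D.I} (hi : i ∈ J) (h : D.InSp J β) :
    D.InSp J (D.act (D.s i) β) := by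
  obtain ⟨c, hc, h⟩ := h
  refine ⟨fun k => c k + (if k = i then - D.coroot (D.simple i) β else 0), ?_, ?_⟩
  · intro k hk
    have : k ≠ i := by rintro rfl; exact hk hi
    simp [hc k hk, this]
  · simp only [add_smul, Finset.sum_add_distrib]
    rw [← single_sum, ← h, s_apply, neg_smul]
    abel

theorem exists_omega (J : Set D.I) : ∃ om : D.V, D.IsIntegral om ∧
    (∀ i ∈ J, D.coroot (D.simple i) om = 0) ∧ (∀ i ∉ J, 0 < D.coroot (D.simple i) om) := by
  refine ⟨∑ β ∈ D.posR.filter (fun β => ¬ D.InSp J β), β, ?_, ?_, ?_⟩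
  · intro γ hγ
    have : ∀ β ∈ D.posR.filter (fun β => ¬ D.InSp J β), ∃ n : ℤ, D.coroot γ β = n := by
      intro β hβ
      exact D.crystallographic _ hγ.1 _ (Finset.mem_filter.1 (Finset.mem_filter.1 hβ).1).1
    choose! f hf using this
    refine ⟨∑ β ∈ D.posR.filter (fun β => ¬ D.InSp J β), f β, ?_⟩
    rw [map_sum]
    push_cast
    exact Finset.sum_congr rfl hf
  · intro i hi
    apply D.coroot_sum_stable
    intro β hβ
    obtain ⟨hβ, hn⟩ := Finset.mem_filter.1 hβ
    obtain ⟨hr, hp⟩ := Finset.mem_filter.1 hβ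
    refine Finset.mem_filter.2 ⟨Finset.mem_filter.2 ⟨D.roots_invariant _ _ hr, ?_⟩, ?_⟩
    · apply (D.s_pos hr hp i).resolve_right
      rintro ⟨c, hc, h⟩
      apply hn
      refine ⟨fun k => if k = i then c else 0, ?_, ?_⟩
      · intro k hk
        have : k ≠ i := by rintro rfl; exact hk hi
        simp [this]
      · rw [← single_sum]; exact h
    · intro h
      apply hn
      rw [← D.s_s_act i β]
      exact InSp.refl D hi h
  · intro i hi
    have h1 := D.rho_pos i
    rw [← Finset.sum_filter_add_sum_filter_not D.posR (fun β => D.InSp J β), map_add] at h1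
    have h2 : D.coroot (D.simple i) (∑ β ∈ D.posR.filter (fun β => D.InSp J β), β) ≤ 0 := by
      rw [map_sum]
      apply Finset.sum_nonpos
      intro β hβ
      obtain ⟨hβ, c, hc, h3⟩ := Finset.mem_filter.1 hβ
      obtain ⟨hr, d, hd, h4⟩ := Finset.mem_filter.1 hβ
      have h5 := D.coef_unique (h3.symm.trans h4)
      rw [h4, map_sum]
      apply Finset.sum_nonpos
      intro k _
      rw [map_smul, smul_eq_mul]
      by_cases hki : k = i
      · rw [hki, ← h5 i, hc i hi, zero_mul]
      · exact mul_nonpos_of_nonneg_of_nonpos (hd k) (D.ca_nonpos hki)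
    linarith

theorem integral_act {pi : D.V} (h : D.IsIntegral pi) (g : D.W) : D.IsIntegral (D.act g pi) := by
  intro β hβ
  have h1 := D.coroot_equivariant g _ (D.roots_invariant g⁻¹ β hβ.1) pi
  rw [act_act_inv] at h1
  rw [h1]
  have hr := D.roots_invariant g⁻¹ β hβ.1
  rcases D.root_pos_or_neg _ hr with hp | hp
  · exact h _ ⟨hr, hp⟩
  · obtain ⟨n, hn⟩ := h _ ⟨D.roots_neg _ hr, hp⟩
    set γ := D.act g⁻¹ β with hγ
    have e1 := D.srefl_apply γ hr γ
    rw [D.coroot_self γ hr, two_smul, sub_add_cancel_left] at e1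
    have e2 := D.coroot_equivariant (D.srefl γ) γ hr pi
    have e3 := D.coroot_self _ (D.roots_neg γ hr)
    rw [map_neg] at e3
    rw [e1, D.srefl_apply γ hr, map_sub, map_smul, smul_eq_mul, hn] at e2
    refine ⟨-n, ?_⟩
    push_cast
    have e4 : D.coroot (-γ) γ = -2 := by linarith
    rw [e4] at e2
    linarith

end WeylSetting

/-- For a `π`-minuscule element `w` and `v ∈ [id,w]^π`, with `H(v)` realized as
an order filter `Fv` of the heap `H(w)` of a reduced word `l` of `w`, the
following are equivalent: (a) there are no nontrivial excited diagrams of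
`H(v)` in `H(w)`, i.e. `|E_{H(w)}(H(v))| = 1`; (b) `w v⁻¹` is `π'`-minuscule
for some dominant integral weight `π'`. -/
theorem excited_iff_minuscule_quotient
    (D : WeylSetting) (pi : D.V) (hpi : D.IsDominant pi)
    (w : D.W) (hw : D.IsMinuscule pi w)
    (v : D.W) (hvr : D.IsMinRep (D.stab pi) v) (hvw : D.bruhatLE v w)
    (l : List D.I) (hl : D.IsReduced l w)
    (Fv : Finset (Fin l.length)) (hfil : D.IsHeapFilter l Fv)
    (hsub : D.wordProd (D.subwordF l Fv) = v) (hcard : Fv.card = D.length v) :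
    (∀ A : Finset (Fin l.length), D.InExcited l Fv A → A = Fv) ↔
      ∃ pi' : D.V, D.IsDominant pi' ∧ D.IsMinuscule pi' (w * v⁻¹) := by
  obtain ⟨l0, hl0, hm0⟩ := hw
  have hm : D.Mn pi l := D.Mn_indep (hl0.1.trans hl.1.symm) (WeylSetting.IsReduced.isRed D hl)
    (D.Mn_fin.2 hm0)
  have hnum : D.NumCond l pi := by
    rw [← D.sw_univ l] at hm
    intro k
    exact (D.Mn_sw l Finset.univ pi).1 (by rw [D.sw_univ] at hm ⊢; exact hm) k (Finset.mem_univ _)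
  have hFm := D.F_num hnum hfil
  have hvpi := D.Mn_sw_act l Fv pi hFm
  rw [hsub] at hvpi
  have hm' := D.Fc_num hnum hfil
  rw [← hvpi] at hm'
  have hu : D.wordProd (D.subwordF l Fvᶜ) = w * v⁻¹ := by
    rw [← hl.1, D.sw_split l Fv hfil, hsub, mul_inv_cancel_right]
  have hured : D.IsReduced (D.subwordF l Fvᶜ) (w * v⁻¹) := by
    refine ⟨hu, le_antisymm ?_ ?_⟩
    · have h1 := D.length_mul_le (w * v⁻¹) v
      rw [inv_mul_cancel_right, ← hl.2, ← hcard] at h1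
      rw [D.sw_length, Finset.card_compl, Fintype.card_fin]
      omega
    · rw [← hu]; exact D.length_le _
  -- (a) and (b) are both equivalent to a positivity condition on `v pi`
  have key : (∀ A : Finset (Fin l.length), D.InExcited l Fv A → A = Fv) ↔
      ∀ k ∉ Fv, 0 ≤ D.coroot (D.simple (l.get k)) (D.act v pi) := by
    rw [hvpi]
    constructor
    · intro h k hk
      by_contra hneg
      obtain ⟨B, hB⟩ := D.neg_excite hpi hnum hfil hk (not_le.1 hneg)
      exact (D.excite_neg hnum hfil hB).1 (h B (Relation.ReflTransGen.single hB))
    · intro h A hA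
      rcases Relation.ReflTransGen.cases_head hA with h1 | ⟨B, hB, _⟩
      · exact h1.symm
      · obtain ⟨_, k, hk, hneg⟩ := D.excite_neg hnum hfil hB
        exact absurd (h k hk) (not_le.2 hneg)
  have hmem : ∀ i, i ∈ D.subwordF l Fvᶜ ↔ ∃ k ∉ Fv, l.get k = i := by
    intro i
    simp [WeylSetting.subwordF]
  rw [key]
  constructor
  · intro h
    obtain ⟨om, ho1, ho2, ho3⟩ := D.exists_omega {i | i ∈ D.subwordF l Fvᶜ}
    have hN : ∃ N : ℕ, ∀ i, i ∉ D.subwordF l Fvᶜ →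
        0 ≤ D.coroot (D.simple i) (D.act v pi) + N * D.coroot (D.simple i) om := by
      have : ∀ i, ∃ n : ℕ, i ∉ D.subwordF l Fvᶜ →
          0 ≤ D.coroot (D.simple i) (D.act v pi) + n * D.coroot (D.simple i) om := by
        intro i
        by_cases hi : i ∈ D.subwordF l Fvᶜ
        · exact ⟨0, fun h => absurd hi h⟩
        · obtain ⟨n, hn⟩ := Archimedean.arch (-D.coroot (D.simple i) (D.act v pi)) (ho3 i hi)
          rw [nsmul_eq_mul] at hn
          exact ⟨n, fun _ => by linarith⟩
      choose n hn using this
      refine ⟨∑ i, n i, fun i hi => (hn i hi).trans ?_⟩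
      have h1 : n i ≤ ∑ i, n i := Finset.single_le_sum (fun _ _ => Nat.zero_le _) (Finset.mem_univ i)
      have h2 : (n i : ℚ) ≤ ((∑ i, n i : ℕ) : ℚ) := by exact_mod_cast h1
      have h3 := mul_le_mul_of_nonneg_right h2 (ho3 i hi).le
      linarith
    obtain ⟨N, hN⟩ := hN
    refine ⟨D.act v pi + (N : ℚ) • om, ⟨?_, ?_⟩, D.subwordF l Fvᶜ, hured, ?_⟩
    · intro β hβ
      obtain ⟨a, ha⟩ := D.integral_act hpi.1 v β hβ
      obtain ⟨b, hb⟩ := ho1 β hβ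
      refine ⟨a + N * b, ?_⟩
      rw [map_add, map_smul, ha, hb, smul_eq_mul]
      push_cast
      ring
    · intro i
      rw [map_add, map_smul, smul_eq_mul]
      by_cases hi : i ∈ D.subwordF l Fvᶜ
      · rw [ho2 i hi, mul_zero, add_zero]
        obtain ⟨k, hk, rfl⟩ := (hmem i).1 hi
        exact h k hk
      · exact hN i hi
    · rw [← D.Mn_fin]
      refine (D.Mn_add hm' ?_).2
      intro i hi
      rw [map_smul, ho2 i hi, smul_zero]
  · rintro ⟨pi', hpi', l1, hl1, hm1⟩ k hk
    have h1 : D.Mn pi' (D.subwordF l Fvᶜ) := D.Mn_indep (hl1.1.trans hu.symm)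
      (WeylSetting.IsReduced.isRed D hured) (D.Mn_fin.2 hm1)
    have h2 := (D.Mn_diff h1 hm').2 (l.get k) ((hmem _).2 ⟨k, hk, rfl⟩)
    rw [map_sub] at h2
    have h3 := hpi'.2 (l.get k)
    linarith
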